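/- arXiv:math/0507066 — 2 statements merged into one kernel-verified Lean document; each statement's English description precedes it below -/
import Mathlib

section
/- Let h : (ℝ × ℂ^p) × ℝ × ℝ^s → ℝ be a polynomial function of degree at most ℓ in (x_0, Re x_j, Im x_j, ν, μ), and let r_1, r_2 : (ℝ × ℂ^p) × ℝ^s → ℝ be polynomial functions of (x, μ) that are T^p-invariant (r_i(x_0, e^{iθ_1}x_1, …, e^{iθ_p}x_p, μ) = r_i(x, μ) for all θ). Suppose that for all (x, ν, μ): ν·(∂h/∂x_0)(x, ν, μ) + (d/ds)|_{s=0} h(x_0, e^{iω_1 s}x_1, …, e^{iω_p s}x_p, ν, μ) + ν·r_1(x, μ) + r_2(x, μ) = 0. Then r_2 is identically zero, and there is a polynomial function m of the variables (|x_1|², …, |x_p|², ν, μ) such that h(x, ν, μ) = − ∫_0^{x_0} r_1((t, x_1, …, x_p), μ) dt − m(|x_1|², …, |x_p|², ν, μ); in particular h is T^p-invariant and ∂h/∂x_0 = −r_1. -/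
noncomputable section

open Complex MeasureTheory

abbrev V (p : ℕ) := ℝ × (Fin p → ℂ)
abbrev W (p s : ℕ) := V p × ℝ × (Fin s → ℝ)

/-- The torus action on `ℝ × ℂ^p`. -/
def torusAct (p : ℕ) (θ : Fin p → ℝ) (x : V p) : V p :=
  (x.1, fun j => Complex.exp (Complex.I * θ j) * x.2 j)

/-- Variable index type for real coordinates on `W p s`. -/
abbrev HVar (p s : ℕ) := (Unit ⊕ Fin p × Bool) ⊕ Unit ⊕ Fin s

/-- Real coordinates of a point of `W p s`. -/
def coordsW {p s : ℕ} (w : W p s) : HVar p s → ℝ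
  | .inl (.inl _) => w.1.1
  | .inl (.inr (j, b)) => if b then (w.1.2 j).re else (w.1.2 j).im
  | .inr (.inl _) => w.2.1
  | .inr (.inr k) => w.2.2 k

/-- Variable index type for real coordinates on `V p × ℝ^s` (no ν). -/
abbrev XVar (p s : ℕ) := (Unit ⊕ Fin p × Bool) ⊕ Fin s

def coordsX {p s : ℕ} (d : V p × (Fin s → ℝ)) : XVar p s → ℝ
  | .inl (.inl _) => d.1.1
  | .inl (.inr (j, b)) => if b then (d.1.2 j).re else (d.1.2 j).im
  | .inr k => d.2 k

/-- `r : V p × ℝ^s → ℝ` is a polynomial function of `(x, μ)`. -/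
def IsPolyX (p s : ℕ) (r : V p × (Fin s → ℝ) → ℝ) : Prop :=
  ∃ P : MvPolynomial (XVar p s) ℝ, ∀ d, r d = MvPolynomial.eval (coordsX d) P

/-- `m : (Fin p → ℝ) × ℝ × ℝ^s → ℝ` is a polynomial function of its variables. -/
def IsPolyM (p s : ℕ) (m : (Fin p → ℝ) × ℝ × (Fin s → ℝ) → ℝ) : Prop :=
  ∃ Q : MvPolynomial (Fin p ⊕ Unit ⊕ Fin s) ℝ,
    ∀ d, m d = MvPolynomial.eval
      (fun v => match v with
        | .inl j => d.1 j
        | .inr (.inl _) => d.2.1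
        | .inr (.inr k) => d.2.2 k) Q

theorem mvPolynomial_eval_polynomial {σ : Type*} (P : MvPolynomial σ ℝ) (c : σ → Polynomial ℝ)
    (t : ℝ) :
    MvPolynomial.eval (fun v => (c v).eval t) P = (MvPolynomial.aeval c P).eval t := by
  induction P using MvPolynomial.induction_on with
  | C a => simp
  | add a b ha hb => simp [ha, hb]
  | mul_X a v ha => simp [ha]

theorem differentiable_eval_coords {E σ : Type*} [NormedAddCommGroup E] [NormedSpace ℝ E]
    (P : MvPolynomial σ ℝ) {c : E → σ → ℝ} (hc : ∀ v, Differentiable ℝ fun w => c w v) :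
    Differentiable ℝ fun w => MvPolynomial.eval (c w) P := by
  induction P using MvPolynomial.induction_on with
  | C a => simp
  | add a b ha hb => simpa only [map_add] using ha.fun_add hb
  | mul_X a v ha => simpa only [map_mul, MvPolynomial.eval_X] using ha.fun_mul (hc v)

theorem differentiable_coordsW {p s : ℕ} (v : HVar p s) :
    Differentiable ℝ fun w : W p s => coordsW w v := by
  have hz (j : Fin p) : Differentiable ℝ fun w : W p s => w.1.2 j := by fun_prop
  rcases v with (_ | ⟨j, b⟩) | _ | k
  · simp only [coordsW]; fun_prop
  · cases b
    · exact Complex.imCLM.differentiable.comp (hz j)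
    · exact Complex.reCLM.differentiable.comp (hz j)
  · simp only [coordsW]; fun_prop
  · simp only [coordsW]; fun_prop

theorem exists_polynomial_derivative_eq (q : Polynomial ℝ) :
    ∃ Q : Polynomial ℝ, Polynomial.derivative Q = q := by
  induction q using Polynomial.induction_on' with
  | add a b ha hb =>
    obtain ⟨A, rfl⟩ := ha
    obtain ⟨B, rfl⟩ := hb
    exact ⟨A + B, by simp⟩
  | monomial n a =>
    refine ⟨Polynomial.monomial (n + 1) (a / (n + 1)), ?_⟩
    rw [Polynomial.derivative_monomial]
    congr 1
    push_cast
    field_simp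

theorem polynomial_eval_eq_of_bounded {P : Polynomial ℝ} {C : ℝ} (hP : ∀ t, |P.eval t| ≤ C)
    (a b : ℝ) : P.eval a = P.eval b := by
  have hb : Filter.atTop.IsBoundedUnder (· ≤ ·) fun x => |P.eval x| :=
    Filter.isBoundedUnder_of ⟨C, hP⟩
  rw [Polynomial.isBoundedUnder_abs_atTop_iff] at hb
  rw [Polynomial.eq_C_of_degree_le_zero hb]
  simp

theorem eq_zero_of_forall_norm_mul_le {a : ℂ} {C : ℝ} (ha : ∀ t : ℝ, ‖(t : ℂ) * a‖ ≤ C) :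
    a = 0 := by
  by_contra hne
  have hpos : 0 < ‖a‖ := norm_pos_iff.mpr hne
  have := ha ((|C| + 1) / ‖a‖)
  rw [norm_mul, Complex.norm_real, Real.norm_of_nonneg (by positivity),
    div_mul_cancel₀ _ hpos.ne'] at this
  linarith [le_abs_self C]

/-- A constant trigonometric sum equals the sum of its terms of frequency zero. -/
theorem eq_sum_filter_of_trigonometric_sum_const {ι : Type*} (S : Finset ι) (c : ι → ℂ)
    (l : ι → ℝ) {A : ℂ}
    (hA : ∀ t : ℝ, ∑ k ∈ S, c k * Complex.exp (Complex.I * l k * t) = A) :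
    A = ∑ k ∈ S with l k = 0, c k := by
  classical
  set B := ∑ k ∈ S with l k = 0, c k
  set g : ℝ → ℂ := fun t =>
    ∑ k ∈ S with ¬ l k = 0, c k * ((Complex.exp (Complex.I * l k * t)) / (Complex.I * l k))
  have hg (t : ℝ) : HasDerivAt (fun t : ℝ => g t - t * (A - B)) 0 t := by
    have hlin (k : ι) : HasDerivAt (fun t : ℝ => Complex.I * l k * (t : ℂ))
        (Complex.I * l k) t := by
      simpa using (Complex.ofRealCLM.hasDerivAt (x := t)).const_mul (Complex.I * (l k : ℂ))
    have h1 : HasDerivAt g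
        (∑ k ∈ S with ¬ l k = 0, c k * Complex.exp (Complex.I * l k * t)) t := by
      refine HasDerivAt.fun_sum fun k hk => ?_
      have hk0 : (l k : ℂ) ≠ 0 := by exact_mod_cast (Finset.mem_filter.mp hk).2
      refine (((hlin k).cexp.div_const (Complex.I * l k)).const_mul (c k)).congr_deriv ?_
      field_simp
    have h2 : HasDerivAt (fun t : ℝ => (t : ℂ) * (A - B)) (A - B) t := by
      simpa using (Complex.ofRealCLM.hasDerivAt (x := t)).mul_const (A - B)
    refine (h1.sub h2).congr_deriv ?_
    have hs := Finset.sum_filter_add_sum_filter_not S (fun k => l k = 0)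
      fun k => c k * Complex.exp (Complex.I * l k * t)
    have hB : ∑ k ∈ S with l k = 0, c k * Complex.exp (Complex.I * l k * t) = B :=
      Finset.sum_congr rfl fun k hk => by simp [(Finset.mem_filter.mp hk).2]
    rw [hA, hB] at hs
    rw [← hs]
    ring
  have hconst (t : ℝ) : g t - t * (A - B) = g 0 - (0 : ℝ) * (A - B) :=
    is_const_of_deriv_eq_zero (fun t => (hg t).differentiableAt) (fun t => (hg t).deriv) t 0
  set C := ∑ k ∈ S with ¬ l k = 0, ‖c k‖ / |l k|
  have hbound (t : ℝ) : ‖g t‖ ≤ C := by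
    refine norm_sum_le_of_le _ fun k _ => ?_
    have : Complex.I * l k * t = ((l k * t : ℝ) : ℂ) * Complex.I := by push_cast; ring
    rw [norm_mul, norm_div, this, Complex.norm_exp_ofReal_mul_I]
    simp [div_eq_mul_inv]
  refine sub_eq_zero.mp (eq_zero_of_forall_norm_mul_le (C := C + C) fun t => ?_)
  have : (t : ℂ) * (A - B) = g t - g 0 := by
    have := hconst t
    simp only [Complex.ofReal_zero, zero_mul, sub_zero] at this
    linear_combination -this
  rw [this]
  exact (norm_sub_le _ _).trans (add_le_add (hbound t) (hbound 0))

/-- The coordinates `(z, conj z, ν, μ)`, in which rotations act diagonally. -/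
def diagonalCoords {p s : ℕ} (z : Fin p → ℂ) (ν : ℝ) (μ : Fin s → ℝ) :
    Fin p ⊕ Fin p ⊕ Unit ⊕ Fin s → ℂ
  | .inl j => z j
  | .inr (.inl j) => (starRingEnd ℂ) (z j)
  | .inr (.inr (.inl _)) => ν
  | .inr (.inr (.inr k)) => μ k

theorem exists_complex_polynomial_diagonalCoords {p s : ℕ} (P : MvPolynomial (HVar p s) ℝ) :
    ∃ R : MvPolynomial (Fin p ⊕ Fin p ⊕ Unit ⊕ Fin s) ℂ, ∀ z ν μ,
      MvPolynomial.eval (diagonalCoords z ν μ) R =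
        ((MvPolynomial.eval (coordsW ((0, z), ν, μ)) P : ℝ) : ℂ) := by
  induction P using MvPolynomial.induction_on with
  | C a => exact ⟨MvPolynomial.C a, by simp⟩
  | add a b ha hb =>
    obtain ⟨A, hA⟩ := ha
    obtain ⟨B, hB⟩ := hb
    exact ⟨A + B, by simp [hA, hB]⟩
  | mul_X a v ha =>
    obtain ⟨A, hA⟩ := ha
    suffices hv : ∃ B : MvPolynomial (Fin p ⊕ Fin p ⊕ Unit ⊕ Fin s) ℂ, ∀ z ν μ,
        MvPolynomial.eval (diagonalCoords z ν μ) B =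
          ((coordsW ((0, z), ν, μ) v : ℝ) : ℂ) by
      obtain ⟨B, hB⟩ := hv
      exact ⟨A * B, by simp [hA, hB]⟩
    rcases v with (_ | ⟨j, b⟩) | _ | k
    · exact ⟨0, by simp [coordsW]⟩
    · cases b
      · refine ⟨MvPolynomial.C (1 / (2 * Complex.I)) *
          (MvPolynomial.X (.inl j) - MvPolynomial.X (.inr (.inl j))), fun z ν μ => ?_⟩
        simp [diagonalCoords, coordsW, Complex.im_eq_sub_conj]
        field_simp
        rw [Complex.I_sq]
        ring
      · refine ⟨MvPolynomial.C (1 / 2) *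
          (MvPolynomial.X (.inl j) + MvPolynomial.X (.inr (.inl j))), fun z ν μ => ?_⟩
        simp [diagonalCoords, coordsW, Complex.re_eq_add_conj]
        field_simp
    · exact ⟨MvPolynomial.X (.inr (.inr (.inl ()))), by simp [diagonalCoords, coordsW]⟩
    · exact ⟨MvPolynomial.X (.inr (.inr (.inr k))), by simp [diagonalCoords, coordsW]⟩

/-- A polynomial constant along the orbits of a nonresonant rotation of `ℂ^p` is a polynomial in
the squared moduli. -/
theorem exists_isPolyM_of_flow_invariant {p s : ℕ} (ω : Fin p → ℝ)
    (hind : ∀ r : Fin p → ℚ, (∑ j, (r j : ℝ) * ω j) = 0 → ∀ j, r j = 0)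
    (P : MvPolynomial (HVar p s) ℝ)
    (hP : ∀ (t : ℝ) z ν μ,
      MvPolynomial.eval (coordsW (torusAct p (fun j => ω j * t) (0, z), ν, μ)) P =
        MvPolynomial.eval (coordsW ((0, z), ν, μ)) P) :
    ∃ m : (Fin p → ℝ) × ℝ × (Fin s → ℝ) → ℝ, IsPolyM p s m ∧ ∀ z ν μ,
      MvPolynomial.eval (coordsW ((0, z), ν, μ)) P = m (fun j => ‖z j‖ ^ 2, ν, μ) := by
  classical
  obtain ⟨R, hR⟩ := exists_complex_polynomial_diagonalCoords P
  set l : (Fin p ⊕ Fin p ⊕ Unit ⊕ Fin s →₀ ℕ) → ℝ := fun d =>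
    ∑ j, ((d (.inl j) : ℝ) - d (.inr (.inl j))) * ω j
  have hl {d} (hd : l d = 0) (j : Fin p) : d (.inr (.inl j)) = d (.inl j) := by
    have := hind (fun j => (d (.inl j) : ℚ) - d (.inr (.inl j))) (by push_cast; exact hd) j
    have h' : (d (.inl j) : ℚ) = d (.inr (.inl j)) := sub_eq_zero.mp this
    exact_mod_cast h'.symm
  set Q : MvPolynomial (Fin p ⊕ Unit ⊕ Fin s) ℝ := ∑ d ∈ R.support with l d = 0,
    MvPolynomial.C (R.coeff d).re * ((∏ j, MvPolynomial.X (.inl j) ^ d (.inl j)) *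
      (MvPolynomial.X (.inr (.inl ())) ^ d (.inr (.inr (.inl ()))) *
        ∏ k, MvPolynomial.X (.inr (.inr k)) ^ d (.inr (.inr (.inr k)))))
  refine ⟨_, ⟨Q, fun d => rfl⟩, fun z ν μ => ?_⟩
  have hmono (d : Fin p ⊕ Fin p ⊕ Unit ⊕ Fin s →₀ ℕ) (t : ℝ) :
      ∏ i, diagonalCoords (torusAct p (fun j => ω j * t) (0, z)).2 ν μ i ^ d i =
        (∏ i, diagonalCoords z ν μ i ^ d i) * Complex.exp (Complex.I * l d * t) := by
    have hexp : Complex.exp (Complex.I * l d * t) =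
        (∏ j, Complex.exp (Complex.I * (ω j * t : ℝ)) ^ d (.inl j)) *
          ∏ j, (starRingEnd ℂ) (Complex.exp (Complex.I * (ω j * t : ℝ))) ^ d (.inr (.inl j)) := by
      rw [← Finset.prod_mul_distrib]
      simp_rw [← Complex.exp_conj, ← Complex.exp_nat_mul, ← Complex.exp_add]
      rw [← Complex.exp_sum]
      congr 1
      simp only [l, map_mul, Complex.conj_I, Complex.conj_ofReal]
      push_cast
      rw [Finset.mul_sum, Finset.sum_mul]
      exact Finset.sum_congr rfl fun j _ => by ring
    rw [hexp]
    simp only [Fintype.prod_sum_type, diagonalCoords, torusAct, map_mul, mul_pow,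
      Finset.prod_mul_distrib]
    ring
  have hsum := eq_sum_filter_of_trigonometric_sum_const R.support
    (fun d => R.coeff d * ∏ i, diagonalCoords z ν μ i ^ d i) l
    (A := ((MvPolynomial.eval (coordsW ((0, z), ν, μ)) P : ℝ) : ℂ)) fun t => by
      rw [← hP t z ν μ]
      have := hR (torusAct p (fun j => ω j * t) (0, z)).2 ν μ
      rw [MvPolynomial.eval_eq'] at this
      refine Eq.trans (Finset.sum_congr rfl fun d _ => ?_) this
      rw [hmono, mul_assoc]
  have hre := congrArg Complex.re hsum
  rw [Complex.ofReal_re, Complex.re_sum] at hre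
  rw [hre, map_sum]
  refine Finset.sum_congr rfl fun d hd => ?_
  have hd0 := hl (Finset.mem_filter.mp hd).2
  have hprod : ∏ i, diagonalCoords z ν μ i ^ d i =
      (((∏ j, (‖z j‖ ^ 2) ^ d (.inl j)) * (ν ^ d (.inr (.inr (.inl ()))) *
        ∏ k, μ k ^ d (.inr (.inr (.inr k)))) : ℝ) : ℂ) := by
    simp only [Fintype.prod_sum_type, diagonalCoords, hd0, ← mul_assoc,
      ← Finset.prod_mul_distrib, ← mul_pow, Complex.mul_conj']
    push_cast
    simp
  rw [hprod, Complex.re_mul_ofReal]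
  simp

theorem norm_torusAct_le {p : ℕ} (θ : Fin p → ℝ) (x : V p) : ‖torusAct p θ x‖ ≤ ‖x‖ := by
  refine norm_prod_le_iff.mpr ⟨norm_fst_le x, ?_⟩
  refine (pi_norm_le_iff_of_nonneg (norm_nonneg _)).mpr fun j => ?_
  have hj : ‖(torusAct p θ x).2 j‖ = ‖x.2 j‖ := by
    simp [torusAct, mul_comm Complex.I, Complex.norm_exp_ofReal_mul_I]
  exact hj.trans_le ((norm_le_pi_norm _ j).trans (norm_snd_le x))

theorem exists_bound_on_torus_orbit {p s : ℕ} {h : W p s → ℝ} (hh : Continuous h) (x : V p)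
    (c : ℝ × (Fin s → ℝ)) : ∃ C, ∀ θ, |h (torusAct p θ x, c)| ≤ C := by
  obtain ⟨C, hC⟩ := (isCompact_closedBall (0 : W p s) ‖(x, c)‖).exists_bound_of_continuousOn
    hh.continuousOn
  refine ⟨C, fun θ => hC _ ?_⟩
  rw [mem_closedBall_zero_iff]
  exact norm_prod_le_iff.mpr
    ⟨(norm_torusAct_le θ x).trans (norm_fst_le (x, c)), norm_snd_le (x, c)⟩

theorem torusAct_torusAct {p : ℕ} (θ η : Fin p → ℝ) (x : V p) :
    torusAct p θ (torusAct p η x) = torusAct p (θ + η) x := by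
  refine Prod.ext rfl (funext fun j => ?_)
  simp only [torusAct, Pi.add_apply]
  rw [← mul_assoc, ← Complex.exp_add]
  push_cast
  ring_nf

theorem torusAct_zero {p : ℕ} (x : V p) : torusAct p 0 x = x :=
  Prod.ext rfl (funext fun j => by simp [torusAct])

/-- The derivative of `h` along an orbit translating `x₀` and rotating the other coordinates. -/
theorem hasDerivAt_along_flow {p s : ℕ} (ω : Fin p → ℝ) {h : W p s → ℝ}
    (hh : Differentiable ℝ h) (x : V p) (ν : ℝ) (c : ℝ × (Fin s → ℝ)) (t : ℝ) :
    HasDerivAt (fun t : ℝ => h (torusAct p (fun j => ω j * t) (x.1 + ν * t, x.2), c))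
      (ν * fderiv ℝ h (torusAct p (fun j => ω j * t) (x.1 + ν * t, x.2), c)
          (((1 : ℝ), (0 : Fin p → ℂ)), (0 : ℝ), (0 : Fin s → ℝ))
        + deriv (fun σ : ℝ => h (torusAct p (fun j => ω j * σ)
            (torusAct p (fun j => ω j * t) (x.1 + ν * t, x.2)), c)) 0) t := by
  have hrot (y : V p) (ν t : ℝ) :
      HasDerivAt (fun t : ℝ => ((torusAct p (fun j => ω j * t) (y.1 + ν * t, y.2), c) : W p s))
        (((ν, fun j => Complex.I * ω j * (torusAct p (fun j => ω j * t) y).2 j), 0) : W p s)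
        t := by
    refine HasDerivAt.prodMk (HasDerivAt.prodMk ?_ (hasDerivAt_pi.mpr fun j => ?_))
      (hasDerivAt_const t c)
    · simpa using ((hasDerivAt_id t).const_mul ν).const_add y.1
    · have h0 : HasDerivAt (fun t : ℝ => Complex.I * ((ω j * t : ℝ) : ℂ)) (Complex.I * ω j) t := by
        simpa [mul_assoc] using
          (Complex.ofRealCLM.hasDerivAt (x := t)).const_mul (Complex.I * (ω j : ℂ))
      refine (h0.cexp.mul_const (y.2 j)).congr_deriv ?_
      simp only [torusAct]
      ring
  set w := torusAct p (fun j => ω j * t) (x.1 + ν * t, x.2)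
  have h1 := (hh (w, c)).hasFDerivAt.comp_hasDerivAt t (hrot x ν t)
  have h2 : HasDerivAt (fun σ : ℝ => h (torusAct p (fun j => ω j * σ) w, c))
      (fderiv ℝ h (w, c) (((0, fun j => Complex.I * ω j * w.2 j), 0) : W p s)) 0 := by
    have h0 : torusAct p (fun j => ω j * 0) w = w := by
      simpa [Pi.zero_def] using torusAct_zero w
    have := hrot w 0 0
    simp only [zero_mul, add_zero, h0] at this
    exact HasFDerivAt.comp_hasDerivAt (0 : ℝ) (by rw [h0]; exact (hh (w, c)).hasFDerivAt) this
  refine h1.congr_deriv ?_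
  rw [h2.deriv, ← smul_eq_mul, ← map_smul, ← map_add]
  congr 1
  simp [w, torusAct]
  rfl

/-- If `h` is a polynomial of degree at most `ℓ` and
`ν·∂h/∂x_0 + (d/ds)|₀ h(flow) + ν r_1 + r_2 = 0` with `r_1, r_2` `T^p`-invariant
polynomial functions of `(x, μ)`, then `r_2 ≡ 0` and
`h = −∫_0^{x_0} r_1 − m(|x_1|², …, |x_p|², ν, μ)`; in particular `h` is
`T^p`-invariant and `∂h/∂x_0 = −r_1`. -/
theorem nilpotent_homological_equation_structure
    (p s ℓ : ℕ) (hp : 1 ≤ p) (hℓ : 2 ≤ ℓ)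
    (ω : Fin p → ℝ) (hω : ∀ j, 0 < ω j)
    (hind : ∀ r : Fin p → ℚ, (∑ j, (r j : ℝ) * ω j) = 0 → ∀ j, r j = 0)
    (h : W p s → ℝ)
    (hpoly : ∃ P : MvPolynomial (HVar p s) ℝ, P.totalDegree ≤ ℓ ∧
      ∀ w, h w = MvPolynomial.eval (coordsW w) P)
    (r1 r2 : V p × (Fin s → ℝ) → ℝ)
    (hr1 : IsPolyX p s r1) (hr2 : IsPolyX p s r2)
    (hr1inv : ∀ (θ : Fin p → ℝ) (x : V p) (μ : Fin s → ℝ),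
      r1 (torusAct p θ x, μ) = r1 (x, μ))
    (hr2inv : ∀ (θ : Fin p → ℝ) (x : V p) (μ : Fin s → ℝ),
      r2 (torusAct p θ x, μ) = r2 (x, μ))
    (heq : ∀ w : W p s,
      w.2.1 * fderiv ℝ h w (((1 : ℝ), (0 : Fin p → ℂ)), (0 : ℝ), (0 : Fin s → ℝ))
        + deriv (fun σ : ℝ => h (torusAct p (fun j => ω j * σ) w.1, w.2)) 0
        + w.2.1 * r1 (w.1, w.2.2) + r2 (w.1, w.2.2) = 0) :
    (∀ (x : V p) (μ : Fin s → ℝ), r2 (x, μ) = 0) ∧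
    (∃ m : (Fin p → ℝ) × ℝ × (Fin s → ℝ) → ℝ, IsPolyM p s m ∧
      ∀ (x : V p) (ν : ℝ) (μ : Fin s → ℝ),
        h (x, ν, μ) = -(∫ t in (0:ℝ)..x.1, r1 ((t, x.2), μ))
          - m (fun j => ‖x.2 j‖ ^ 2, ν, μ)) ∧
    (∀ (θ : Fin p → ℝ) (x : V p) (ν : ℝ) (μ : Fin s → ℝ),
      h (torusAct p θ x, ν, μ) = h (x, ν, μ)) ∧
    (∀ w : W p s,
      fderiv ℝ h w (((1 : ℝ), (0 : Fin p → ℂ)), (0 : ℝ), (0 : Fin s → ℝ))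
        = - r1 (w.1, w.2.2)) := by
  obtain ⟨P, -, hP⟩ := hpoly
  obtain ⟨P1, hP1⟩ := hr1
  have hdiff : Differentiable ℝ h := by
    rw [funext hP]
    exact differentiable_eval_coords P differentiable_coordsW
  have hflow (x : V p) (ν : ℝ) (μ : Fin s → ℝ) (t : ℝ) :
      HasDerivAt (fun t : ℝ => h (torusAct p (fun j => ω j * t) (x.1 + ν * t, x.2), ν, μ))
        (-(ν * r1 ((x.1 + ν * t, x.2), μ)) - r2 ((x.1 + ν * t, x.2), μ)) t := by
    refine (hasDerivAt_along_flow ω hdiff x ν (ν, μ) t).congr_deriv ?_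
    have := heq (torusAct p (fun j => ω j * t) (x.1 + ν * t, x.2), ν, μ)
    simp only [hr1inv, hr2inv] at this
    linarith
  have hr2zero (x : V p) (μ : Fin s → ℝ) : r2 (x, μ) = 0 := by
    obtain ⟨C, hC⟩ := exists_bound_on_torus_orbit hdiff.continuous x ((0 : ℝ), μ)
    have hd (t : ℝ) : HasDerivAt
        (fun t : ℝ => h (torusAct p (fun j => ω j * t) x, (0 : ℝ), μ) + t * r2 (x, μ)) 0 t := by
      have h1 := hflow x 0 μ t
      simp only [zero_mul, add_zero, neg_zero, zero_sub] at h1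
      simpa using h1.fun_add ((hasDerivAt_id t).mul_const (r2 (x, μ)))
    have hconst (t : ℝ) := is_const_of_deriv_eq_zero (fun t => (hd t).differentiableAt)
      (fun t => (hd t).deriv) t 0
    have hz : ((r2 (x, μ) : ℝ) : ℂ) = 0 := by
      refine eq_zero_of_forall_norm_mul_le (C := C + C) fun t => ?_
      rw [← Complex.ofReal_mul, Complex.norm_real, Real.norm_eq_abs]
      have ht := hconst t
      rw [zero_mul, add_zero] at ht
      rw [← eq_sub_iff_add_eq'] at ht
      rw [ht]
      exact (abs_sub _ _).trans (add_le_add (hC _) (hC _))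
    exact_mod_cast hz
  have huni (y : Fin p → ℂ) (ν : ℝ) (μ : Fin s → ℝ) :
      ∃ H Q : Polynomial ℝ, (∀ t, h ((t, y), ν, μ) = H.eval t) ∧
        (∀ t, r1 ((t, y), μ) = Q.derivative.eval t) := by
    obtain ⟨Q, hQ⟩ := exists_polynomial_derivative_eq (MvPolynomial.aeval
      (fun v : XVar p s => match v with
        | .inl (.inl _) => Polynomial.X
        | v => Polynomial.C (coordsX (((0 : ℝ), y), μ) v)) P1)
    refine ⟨MvPolynomial.aeval (fun v : HVar p s => match v with
        | .inl (.inl _) => Polynomial.X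
        | v => Polynomial.C (coordsW (((0 : ℝ), y), ν, μ) v)) P, Q, fun t => ?_, fun t => ?_⟩
    · rw [hP, ← mvPolynomial_eval_polynomial]
      congr 2
      funext v
      rcases v with (_ | ⟨j, b⟩) | _ | k <;> simp [coordsW]
    · rw [hP1, hQ, ← mvPolynomial_eval_polynomial]
      congr 2
      funext v
      rcases v with (_ | ⟨j, b⟩) | k <;> simp [coordsX]
  have hcons (y : Fin p → ℂ) (ν : ℝ) (μ : Fin s → ℝ) (Q : Polynomial ℝ)
      (hQ : ∀ t, r1 ((t, y), μ) = Q.derivative.eval t) (t : ℝ) :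
      h (torusAct p (fun j => ω j * t) (ν * t, y), ν, μ) + Q.eval (ν * t) =
        h ((0, y), ν, μ) + Q.eval 0 := by
    have hd (t : ℝ) : HasDerivAt (fun t : ℝ =>
        h (torusAct p (fun j => ω j * t) (ν * t, y), ν, μ) + Q.eval (ν * t)) 0 t := by
      have h1 := hflow (0, y) ν μ t
      simp only [zero_add] at h1
      have h2 : HasDerivAt (fun t => Q.eval (ν * t)) (Q.derivative.eval (ν * t) * ν) t := by
        have hlin : HasDerivAt (fun t => ν * t) ν t := by
          simpa using (hasDerivAt_id t).const_mul ν
        exact (Q.hasDerivAt (ν * t)).comp t hlin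
      refine (h1.fun_add h2).congr_deriv ?_
      rw [hr2zero, hQ]
      ring
    have := is_const_of_deriv_eq_zero (fun t => (hd t).differentiableAt)
      (fun t => (hd t).deriv) t 0
    simp only [mul_zero] at this
    rw [this]
    congr 2
    exact Prod.ext (torusAct_zero _) rfl
  have hr1rot (θ : Fin p → ℝ) (y : Fin p → ℂ) (μ : Fin s → ℝ) (t : ℝ) :
      r1 ((t, (torusAct p θ (0, y)).2), μ) = r1 ((t, y), μ) := hr1inv θ (t, y) μ
  have hne (y : Fin p → ℂ) (ν : ℝ) (hν : ν ≠ 0) (μ : Fin s → ℝ) (Q : Polynomial ℝ)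
      (hQ : ∀ t, r1 ((t, y), μ) = Q.derivative.eval t) (u : ℝ) :
      h ((u, y), ν, μ) + Q.eval u = h ((0, y), ν, μ) + Q.eval 0 := by
    obtain ⟨H, -, hH, -⟩ := huni y ν μ
    obtain ⟨C, hC⟩ := exists_bound_on_torus_orbit hdiff.continuous (0, y) (ν, μ)
    have hb (u : ℝ) : |(H + Q).eval u| ≤ C + |Q.eval 0| := by
      have hc := hcons (torusAct p (-fun j => ω j * (u / ν)) (0, y)).2 ν μ Q
        (fun t => by rw [hr1rot, hQ]) (u / ν)
      rw [mul_div_cancel₀ _ hν] at hc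
      have hback : torusAct p (fun j => ω j * (u / ν))
          (u, (torusAct p (-fun j => ω j * (u / ν)) (0, y)).2) = (u, y) := by
        have := torusAct_torusAct (fun j => ω j * (u / ν)) (-fun j => ω j * (u / ν)) (u, y)
        rw [add_neg_cancel, torusAct_zero] at this
        exact this
      rw [hback, hH] at hc
      rw [Polynomial.eval_add, hc]
      exact (abs_add_le _ _).trans (add_le_add_left (hC _) _)
    simpa [hH] using polynomial_eval_eq_of_bounded hb u 0
  have hall (y : Fin p → ℂ) (ν : ℝ) (μ : Fin s → ℝ) (Q : Polynomial ℝ)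
      (hQ : ∀ t, r1 ((t, y), μ) = Q.derivative.eval t) (u : ℝ) :
      h ((u, y), ν, μ) + Q.eval u = h ((0, y), ν, μ) + Q.eval 0 := by
    have hc := hdiff.continuous
    have hf : Continuous fun ν : ℝ => h ((u, y), ν, μ) + Q.eval u := by fun_prop
    have hg : Continuous fun ν : ℝ => h ((0, y), ν, μ) + Q.eval 0 := by fun_prop
    exact congrFun (Continuous.ext_on (dense_compl_singleton (0 : ℝ)) hf hg
      fun ν hν => hne y ν hν μ Q hQ u) ν
  have hintegral (y : Fin p → ℂ) (μ : Fin s → ℝ) (Q : Polynomial ℝ)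
      (hQ : ∀ t, r1 ((t, y), μ) = Q.derivative.eval t) (u : ℝ) :
      ∫ t in (0 : ℝ)..u, r1 ((t, y), μ) = Q.eval u - Q.eval 0 := by
    simp_rw [hQ]
    exact intervalIntegral.integral_eq_sub_of_hasDerivAt (fun t _ => Q.hasDerivAt t)
      (Q.derivative.continuous.intervalIntegrable _ _)
  have hformula (x : V p) (ν : ℝ) (μ : Fin s → ℝ) :
      h (x, ν, μ) = -(∫ t in (0 : ℝ)..x.1, r1 ((t, x.2), μ)) + h ((0, x.2), ν, μ) := by
    obtain ⟨-, Q, -, hQ⟩ := huni x.2 ν μ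
    rw [hintegral x.2 μ Q hQ]
    have := hall x.2 ν μ Q hQ x.1
    linarith
  have hinv (t : ℝ) (z : Fin p → ℂ) (ν : ℝ) (μ : Fin s → ℝ) :
      MvPolynomial.eval (coordsW (torusAct p (fun j => ω j * t) (0, z), ν, μ)) P =
        MvPolynomial.eval (coordsW ((0, z), ν, μ)) P := by
    rw [← hP, ← hP]
    obtain ⟨-, Q, -, hQ⟩ := huni z ν μ
    have h1 := hcons z ν μ Q hQ t
    have h2 := hall (torusAct p (fun j => ω j * t) (0, z)).2 ν μ Q
      (fun u => by rw [hr1rot, hQ]) (ν * t)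
    exact add_right_cancel (h2.symm.trans h1)
  obtain ⟨m, ⟨Q, hQ⟩, hm⟩ := exists_isPolyM_of_flow_invariant ω hind P hinv
  have hmain (x : V p) (ν : ℝ) (μ : Fin s → ℝ) :
      h (x, ν, μ) = -(∫ t in (0 : ℝ)..x.1, r1 ((t, x.2), μ))
        + m (fun j => ‖x.2 j‖ ^ 2, ν, μ) := by
    rw [hformula, hP ((0, x.2), ν, μ), hm]
  refine ⟨hr2zero, ⟨fun d => -m d, ⟨-Q, fun d => by simp only [hQ, map_neg]⟩, fun x ν μ => ?_⟩,
    fun θ x ν μ => ?_, fun w => ?_⟩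
  · rw [hmain, sub_neg_eq_add]
  · have hnorm : (fun j => ‖(torusAct p θ x).2 j‖ ^ 2) = fun j => ‖x.2 j‖ ^ 2 := by
      funext j
      simp [torusAct, mul_comm Complex.I, Complex.norm_exp_ofReal_mul_I]
    have hr (t : ℝ) : r1 ((t, (torusAct p θ x).2), μ) = r1 ((t, x.2), μ) := hr1inv θ (t, x.2) μ
    rw [hmain, hmain x, hnorm]
    simp_rw [hr]
    rfl
  · obtain ⟨⟨u, y⟩, ν, μ⟩ := w
    obtain ⟨-, Q, -, hQ⟩ := huni y ν μ
    have hline : HasDerivAt (fun t : ℝ => (((t, y), ν, μ) : W p s))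
        (((1 : ℝ), (0 : Fin p → ℂ)), (0 : ℝ), (0 : Fin s → ℝ)) u :=
      ((hasDerivAt_id u).prodMk (hasDerivAt_const u y)).prodMk (hasDerivAt_const u (ν, μ))
    have h1 := (hdiff ((u, y), ν, μ)).hasFDerivAt.comp_hasDerivAt u hline
    have h2 : HasDerivAt (fun t : ℝ => h ((0, y), ν, μ) + Q.eval 0 - Q.eval t)
        (-Q.derivative.eval u) u := (Q.hasDerivAt u).const_sub _
    have hfun : (h ∘ fun t : ℝ => (((t, y), ν, μ) : W p s)) =
        fun t : ℝ => h ((0, y), ν, μ) + Q.eval 0 - Q.eval t :=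
      funext fun t => eq_sub_of_add_eq (hall y ν μ Q hQ t)
    rw [hfun] at h1
    rw [h1.unique h2, hQ]

end
end

section
/- Let ω_1, …, ω_p be positive reals that are rationally independent, and let g : T^p → ℝ be a continuous function on the p-torus T^p = (ℝ/2πℤ)^p. Then the time averages of g along the linear flow converge to its Haar average: lim_{T→∞} (1/T) ∫_0^T g(ω_1 s mod 2π, …, ω_p s mod 2π) ds = ∫_{T^p} g dγ, where dγ is the normalized Haar measure on T^p. -/
noncomputable section

open MeasureTheory Filter Topology

instance : Fact (0 < 2 * Real.pi) := ⟨Real.two_pi_pos⟩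

/-- If a family of continuous functions spans a dense subspace of `C(X, ℂ)`, then convergence of the
time averages along a curve to the space average holds for all continuous functions as soon as it
holds for that family. -/
theorem tendsto_timeAverage_of_span_dense {X : Type*} [TopologicalSpace X] [CompactSpace X]
    [MeasurableSpace X] [BorelSpace X] (μ : Measure X) [IsProbabilityMeasure μ]
    {x : ℝ → X} (hx : Continuous x) {S : Set C(X, ℂ)}
    (hS : (Submodule.span ℂ S).topologicalClosure = ⊤)
    (h : ∀ f ∈ S, Tendsto (fun T : ℝ => (1 / T) • ∫ t in (0 : ℝ)..T, f (x t)) atTop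
      (𝓝 (∫ y, f y ∂μ))) (f : C(X, ℂ)) :
    Tendsto (fun T : ℝ => (1 / T) • ∫ t in (0 : ℝ)..T, f (x t)) atTop (𝓝 (∫ y, f y ∂μ)) := by
  have hint (f : C(X, ℂ)) : Integrable (fun y => f y) μ :=
    f.continuous.integrable_of_hasCompactSupport (.of_compactSpace f)
  have hint' (f : C(X, ℂ)) (T : ℝ) : IntervalIntegrable (fun t => f (x t)) volume 0 T :=
    (f.continuous.comp hx).intervalIntegrable _ _
  have hμ : LipschitzWith 1 (fun f : C(X, ℂ) => ∫ y, f y ∂μ) := by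
    refine LipschitzWith.of_dist_le_mul fun f g => ?_
    rw [dist_eq_norm, dist_eq_norm, ← integral_sub (hint f) (hint g)]
    simpa using norm_integral_le_of_norm_le_const (μ := μ)
      (.of_forall fun y => (f - g).norm_coe_le_norm y)
  have havg (T : ℝ) :
      LipschitzWith 1 (fun f : C(X, ℂ) => (1 / T) • ∫ t in (0 : ℝ)..T, f (x t)) := by
    refine LipschitzWith.of_dist_le_mul fun f g => ?_
    rw [dist_eq_norm, dist_eq_norm, ← smul_sub,
      ← intervalIntegral.integral_sub (hint' f T) (hint' g T), norm_smul]
    have hle := intervalIntegral.norm_integral_le_of_norm_le_const (a := 0) (b := T)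
      (f := fun t => f (x t) - g (x t)) fun t _ => (f - g).norm_coe_le_norm (x t)
    calc ‖1 / T‖ * ‖∫ t in (0 : ℝ)..T, f (x t) - g (x t)‖
        ≤ ‖1 / T‖ * (‖f - g‖ * |T - 0|) := by gcongr
      _ = ‖f - g‖ * (|T|⁻¹ * |T|) := by simp [mul_left_comm]
      _ ≤ ‖f - g‖ * 1 := by gcongr; exact inv_mul_le_one
      _ = (1 : NNReal) * ‖f - g‖ := by simp
  have hclosed := (LipschitzWith.uniformEquicontinuous _ 1 havg).equicontinuous
    |>.isClosed_setOfPred_tendsto (l := atTop) hμ.continuous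
  have hspan : (Submodule.span ℂ S : Set C(X, ℂ)) ⊆
      {f | Tendsto (fun T : ℝ => (1 / T) • ∫ t in (0 : ℝ)..T, f (x t)) atTop
        (𝓝 (∫ y, f y ∂μ))} := by
    intro f hf
    induction hf using Submodule.span_induction with
    | mem f hf => exact h f hf
    | zero => simp
    | add f g _ _ hf hg =>
      simpa [integral_add (hint f) (hint g), intervalIntegral.integral_add (hint' f _) (hint' g _),
        mul_add] using hf.add hg
    | smul c f _ hf =>
      simpa [integral_const_mul, mul_left_comm] using hf.const_mul c
  have hf : f ∈ (Submodule.span ℂ S).topologicalClosure := hS ▸ Submodule.mem_top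
  exact closure_minimal hspan hclosed hf

/-- The time averages of `t ↦ exp (a t I)` tend to `0` when `a ≠ 0`. -/
theorem tendsto_timeAverage_exp_mul_I {a : ℝ} (ha : a ≠ 0) :
    Tendsto (fun T : ℝ => (1 / T) • ∫ t in (0 : ℝ)..T, Complex.exp ((a * t : ℝ) * Complex.I))
      atTop (𝓝 0) := by
  have hc : (a : ℂ) * Complex.I ≠ 0 := by simp [ha]
  have hbound (T : ℝ) :
      ‖∫ t in (0 : ℝ)..T, Complex.exp ((a * t : ℝ) * Complex.I)‖ ≤ 2 / |a| := by
    have heq (t : ℝ) : ((a * t : ℝ) : ℂ) * Complex.I = a * Complex.I * t := by push_cast; ring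
    simp_rw [heq]
    rw [integral_exp_mul_complex hc, norm_div, ← heq, ← heq]
    have := norm_sub_le (Complex.exp ((a * T : ℝ) * Complex.I))
      (Complex.exp ((a * (0 : ℝ) : ℝ) * Complex.I))
    rw [Complex.norm_exp_ofReal_mul_I, Complex.norm_exp_ofReal_mul_I] at this
    rw [norm_mul, Complex.norm_I, mul_one, Complex.norm_real, Real.norm_eq_abs]
    gcongr
    linarith
  have hinv : Tendsto (fun T : ℝ => 1 / T) atTop (𝓝 0) := by
    simpa using tendsto_inv_atTop_zero (𝕜 := ℝ)
  exact hinv.zero_smul_isBoundedUnder_le (isBoundedUnder_of ⟨2 / |a|, hbound⟩)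

section Characters

variable {ι : Type*} [Fintype ι] {L : ℝ}

/-- The character `x ↦ ∏ i, fourier (n i) (x i)` of the torus `(ℝ / Lℤ)^ι`. -/
def torusCharacter (L : ℝ) (n : ι → ℤ) : C(ι → AddCircle L, ℂ) where
  toFun x := ∏ i, fourier (n i) (x i)
  continuous_toFun := by fun_prop

theorem torusCharacter_apply (n : ι → ℤ) (x : ι → AddCircle L) :
    torusCharacter L n x = ∏ i, fourier (n i) (x i) := rfl

theorem torusCharacter_single [DecidableEq ι] (i : ι) (x : ι → AddCircle L) :
    torusCharacter L (Pi.single i 1) x = fourier 1 (x i) := by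
  rw [torusCharacter_apply, Finset.prod_eq_single i]
  · rw [Pi.single_eq_same]
  · intro j _ hj
    rw [Pi.single_eq_of_ne hj, fourier_zero]
  · simp

/-- The star subalgebra of `C((ℝ / Lℤ)^ι, ℂ)` generated by the characters. -/
def torusCharacterSubalgebra (ι : Type*) [Fintype ι] (L : ℝ) :
    StarSubalgebra ℂ C(ι → AddCircle L, ℂ) where
  toSubalgebra := Algebra.adjoin ℂ (Set.range (torusCharacter L))
  star_mem' := by
    change Algebra.adjoin ℂ (Set.range (torusCharacter (ι := ι) L)) ≤
      star (Algebra.adjoin ℂ (Set.range (torusCharacter (ι := ι) L)))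
    refine Algebra.adjoin_le ?_
    rintro _ ⟨n, rfl⟩
    refine Algebra.subset_adjoin ⟨-n, ?_⟩
    ext1 x
    rw [ContinuousMap.star_apply, ← starRingEnd_apply]
    simp only [torusCharacter_apply, Pi.neg_apply, fourier_neg, map_prod]

theorem torusCharacterSubalgebra_toSubmodule :
    (torusCharacterSubalgebra ι L).toSubalgebra.toSubmodule =
      Submodule.span ℂ (Set.range (torusCharacter L)) := by
  apply Algebra.adjoin_eq_span_of_subset
  refine .trans (fun x ↦ Submonoid.closure_induction (fun _ ↦ id) ⟨0, ?_⟩ ?_)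
    Submodule.subset_span
  · ext x
    simp only [torusCharacter_apply, Pi.zero_apply, fourier_zero, Finset.prod_const_one,
      ContinuousMap.one_apply]
  · rintro _ _ _ _ ⟨m, rfl⟩ ⟨n, rfl⟩
    refine ⟨m + n, ?_⟩
    ext x
    simp only [torusCharacter_apply, Pi.add_apply, fourier_add, Finset.prod_mul_distrib,
      ContinuousMap.mul_apply]

theorem torusCharacterSubalgebra_separatesPoints (hL : L ≠ 0) :
    (torusCharacterSubalgebra ι L).SeparatesPoints := by
  classical
  intro x y hxy
  obtain ⟨i, hi⟩ := Function.ne_iff.mp hxy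
  refine ⟨_, ⟨torusCharacter L (Pi.single i 1),
    Algebra.subset_adjoin ⟨Pi.single i 1, rfl⟩, rfl⟩, ?_⟩
  change torusCharacter L (Pi.single i 1) x ≠ torusCharacter L (Pi.single i 1) y
  rw [torusCharacter_single, torusCharacter_single, fourier_one, fourier_one]
  exact fun h => hi (AddCircle.injective_toCircle hL (Circle.ext h))

/-- Trigonometric polynomials are dense in the continuous functions on the torus. -/
theorem span_torusCharacter_closure_eq_top [Fact (0 < L)] :
    (Submodule.span ℂ (Set.range (torusCharacter (ι := ι) L))).topologicalClosure = ⊤ := by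
  rw [← torusCharacterSubalgebra_toSubmodule]
  exact congr_arg (Subalgebra.toSubmodule <| StarSubalgebra.toSubalgebra ·)
    (ContinuousMap.starSubalgebra_topologicalClosure_eq_top_of_separatesPoints
      (torusCharacterSubalgebra ι L)
      (torusCharacterSubalgebra_separatesPoints (Fact.out : 0 < L).ne'))

theorem integral_fourier_eq_zero [Fact (0 < L)] {n : ℤ} (hn : n ≠ 0) :
    ∫ x : AddCircle L, fourier n x = 0 := by
  have h := congr_fun (fourierCoeff_fourier (T := L) n) 0
  rw [Pi.single_eq_of_ne hn.symm] at h
  have hL : L ≠ 0 := (Fact.out : 0 < L).ne'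
  simpa [fourierCoeff, AddCircle.integral_haarAddCircle, hL] using h

theorem integral_torusCharacter_eq_zero [Fact (0 < L)] {n : ι → ℤ} (hn : n ≠ 0) :
    ∫ x, torusCharacter L n x = 0 := by
  obtain ⟨i, hi⟩ := Function.ne_iff.mp hn
  simp_rw [torusCharacter_apply]
  rw [integral_fintype_prod_volume_eq_prod (f := fun i (x : AddCircle L) => fourier (n i) x)]
  exact Finset.prod_eq_zero (Finset.mem_univ i) (integral_fourier_eq_zero hi)

theorem torusCharacter_linearFlow (n : ι → ℤ) (ω : ι → ℝ) (t : ℝ) :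
    torusCharacter (2 * Real.pi) n (fun j => ((ω j * t : ℝ) : AddCircle (2 * Real.pi))) =
      Complex.exp (((∑ j, n j * ω j) * t : ℝ) * Complex.I) := by
  simp_rw [torusCharacter_apply, fourier_coe_apply]
  rw [← Complex.exp_sum]
  congr 1
  push_cast
  rw [Finset.sum_mul, Finset.sum_mul]
  refine Finset.sum_congr rfl fun j _ => ?_
  have : (Real.pi : ℂ) ≠ 0 := by exact_mod_cast Real.pi_ne_zero
  field_simp

end Characters

/-- The Haar measure of total mass `1` on the torus `(ℝ / 2πℤ)^ι`. -/
def torusProbability (ι : Type*) [Fintype ι] : Measure (ι → AddCircle (2 * Real.pi)) :=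
  ENNReal.ofReal ((2 * Real.pi) ^ Fintype.card ι)⁻¹ • volume

instance (ι : Type*) [Fintype ι] : IsProbabilityMeasure (torusProbability ι) where
  measure_univ := by
    have hpos : 0 < (2 * Real.pi) ^ Fintype.card ι := pow_pos Real.two_pi_pos _
    rw [torusProbability, Measure.smul_apply, volume_pi, Measure.pi_univ]
    simp only [AddCircle.measure_univ, Finset.prod_const, Finset.card_univ, smul_eq_mul]
    rw [← ENNReal.ofReal_pow Real.two_pi_pos.le, ← ENNReal.ofReal_mul (inv_pos.mpr hpos).le,
      inv_mul_cancel₀ hpos.ne', ENNReal.ofReal_one]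

theorem integral_torusProbability {ι : Type*} [Fintype ι] {E : Type*} [NormedAddCommGroup E]
    [NormedSpace ℝ E] (f : (ι → AddCircle (2 * Real.pi)) → E) :
    ∫ x, f x ∂torusProbability ι = ((2 * Real.pi) ^ Fintype.card ι)⁻¹ • ∫ x, f x := by
  rw [torusProbability, integral_smul_measure,
    ENNReal.toReal_ofReal (inv_pos.mpr (pow_pos Real.two_pi_pos _)).le]

/-- **unique ergodicity of irrational linear flows.** If `ω_1, …, ω_p` are
positive and rationally independent, then for every continuous `g : T^p → ℝ` the time
averages of `g` along the linear flow converge to the normalized Haar average of `g`. -/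
theorem time_average_tendsto_haar_average
    (p : ℕ) (hp : 1 ≤ p) (ω : Fin p → ℝ) (hω : ∀ j, 0 < ω j)
    (hind : ∀ r : Fin p → ℚ, (∑ j, (r j : ℝ) * ω j) = 0 → ∀ j, r j = 0)
    (g : (Fin p → AddCircle (2 * Real.pi)) → ℝ) (hg : Continuous g) :
    Tendsto
      (fun T : ℝ => (1 / T) * ∫ t in (0:ℝ)..T,
        g (fun j => ((ω j * t : ℝ) : AddCircle (2 * Real.pi))))
      atTop
      (𝓝 (((2 * Real.pi) ^ p)⁻¹ * ∫ γ : Fin p → AddCircle (2 * Real.pi), g γ)) := by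
  let F : C(Fin p → AddCircle (2 * Real.pi), ℂ) := ⟨fun x => (g x : ℂ), by fun_prop⟩
  have hflow : Continuous
      (fun (t : ℝ) (j : Fin p) => ((ω j * t : ℝ) : AddCircle (2 * Real.pi))) :=
    continuous_pi fun j => (AddCircle.continuous_mk' _).comp (continuous_const.mul continuous_id)
  have hF := tendsto_timeAverage_of_span_dense (torusProbability (Fin p)) hflow
    span_torusCharacter_closure_eq_top ?_ F
  · have hre := (Complex.continuous_re.tendsto _).comp hF
    simpa [F, Function.comp_def, integral_torusProbability, integral_complex_ofReal,
      intervalIntegral.integral_ofReal, ← Complex.ofReal_pow, ← Complex.ofReal_inv,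
      ← Complex.ofReal_ofNat, ← Complex.ofReal_mul] using hre
  · rintro _ ⟨n, rfl⟩
    simp_rw [torusCharacter_linearFlow]
    rcases eq_or_ne n 0 with rfl | hn
    · have h : torusCharacter (2 * Real.pi) (0 : Fin p → ℤ) = 1 := by
        ext x
        simp [torusCharacter_apply]
      refine tendsto_const_nhds.congr' ?_
      filter_upwards [eventually_ne_atTop 0] with T hT
      simp [h, hT]
    · have hne : ∑ j, (n j : ℝ) * ω j ≠ 0 := fun h0 => hn <| funext fun j => by
        exact_mod_cast hind (fun j => n j) (by exact_mod_cast h0) j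
      rw [integral_torusProbability, integral_torusCharacter_eq_zero hn, smul_zero]
      exact tendsto_timeAverage_exp_mul_I hne

end
end
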